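/- For every parameter (a,b) in the hyperbolic set H, the map f_{a,b} has exactly one attracting periodic orbit. -/

import Mathlib

open Set Filter Topology

noncomputable section

/-- Representative of a point of the circle in `[0,1)`. -/
noncomputable def rep (z : UnitAddCircle) : ℝ := (AddCircle.equivIco 1 0 z).val

/-- The straight sine map on `[0,1)`. -/
noncomputable def Sfun (t : ℝ) : ℝ := if t ≤ 1/2 then 4*t - 1 else -4*t + 3

/-- The piecewise linear perturbation of the doubling map. -/
noncomputable def plpdm (a : UnitAddCircle) (b : ℝ) (z : UnitAddCircle) : UnitAddCircle :=
  ((2 * rep z + (b/2) * Sfun (rep z) : ℝ) : UnitAddCircle) + a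

/-- The doubling map. -/
def Dbl (z : UnitAddCircle) : UnitAddCircle := z + z

/-- `x` is an attracting periodic point of `f` of exact period `n`. -/
def IsAttractingPeriodicPt (f : UnitAddCircle → UnitAddCircle) (n : ℕ)
    (x : UnitAddCircle) : Prop :=
  0 < n ∧ f^[n] x = x ∧ (∀ m, 0 < m → m < n → f^[m] x ≠ x) ∧
  ∃ U : Set UnitAddCircle, IsOpen U ∧ IsConnected U ∧ x ∈ U ∧ f^[n] '' U ⊆ U ∧
    ∀ y ∈ U, Tendsto (fun k => f^[n*k] y) atTop (nhds x)

/-- Forward orbit of `x` under `f`. -/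
def orbitSet (f : UnitAddCircle → UnitAddCircle) (x : UnitAddCircle) : Set UnitAddCircle :=
  {y | ∃ i, f^[i] x = y}

/-- Basin of attraction of the set `O`. -/
def basin (f : UnitAddCircle → UnitAddCircle) (O : Set UnitAddCircle) : Set UnitAddCircle :=
  {y | Tendsto (fun k => Metric.infDist (f^[k] y) O) atTop (nhds 0)}

/-- Immediate basin of attraction of the orbit `O`. -/
def immBasin (f : UnitAddCircle → UnitAddCircle) (O : Set UnitAddCircle) :
    Set UnitAddCircle :=
  ⋃ z ∈ O, connectedComponentIn (basin f O) z

/-- The hyperbolic set `H`. -/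
def hypSet : Set (UnitAddCircle × ℝ) :=
  {q | q.2 ∈ Set.Ico (0:ℝ) 1 ∧ ∃ n x, IsAttractingPeriodicPt (plpdm q.1 q.2) n x}

/-- The lift `F_{a,b}` of `f_{a,b}`, normalized so that `F_{a,b}(0) ∈ [0,1)`. -/
noncomputable def liftF (a : UnitAddCircle) (b : ℝ) (x : ℝ) : ℝ :=
  (2 * Int.fract x + rep a + (b/2) * Sfun (Int.fract x)
    + (if rep a - b/2 < 0 then 1 else 0)) + 2 * (⌊x⌋ : ℝ)

/-- `Φ_{a,b}`, the limit of `F_{a,b}^n(x)/2^n`. -/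
noncomputable def Phi (a : UnitAddCircle) (b : ℝ) (x : ℝ) : ℝ :=
  limUnder atTop (fun n : ℕ => (liftF a b)^[n] x / 2 ^ n)

/-- The semiconjugacy `φ_{a,b}` induced by `Φ_{a,b}`. -/
noncomputable def phiMap (a : UnitAddCircle) (b : ℝ) (z : UnitAddCircle) : UnitAddCircle :=
  ((Phi a b (rep z) : ℝ) : UnitAddCircle)

/-- The arc `I₊ = [0,1/2]` of the circle. -/
def Iplus : Set UnitAddCircle := (fun t : ℝ => (t : UnitAddCircle)) '' Set.Icc 0 (1/2)

/-- The arc `I₋ = [1/2,1]` of the circle. -/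
def Iminus : Set UnitAddCircle := (fun t : ℝ => (t : UnitAddCircle)) '' Set.Icc (1/2) 1

/-- The orbit of `x` (of period `p`) avoids `0`, `1/2` and has slope itinerary `σ`,
where `σ j = true` encodes the symbol `−` and `σ j = false` encodes `+`. -/
def HasItinerary (f : UnitAddCircle → UnitAddCircle) (p : ℕ) (x : UnitAddCircle)
    (σ : Fin p → Bool) : Prop :=
  (∀ j : Fin p, f^[(j : ℕ)] x ≠ (0 : UnitAddCircle) ∧
      f^[(j : ℕ)] x ≠ (((1:ℝ)/2 : ℝ) : UnitAddCircle)) ∧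
  ∀ j : Fin p, (σ j = true → f^[(j : ℕ)] x ∈ Iminus) ∧ (σ j = false → f^[(j : ℕ)] x ∈ Iplus)

/-- The set `P_σ` of parameters whose attracting orbit has slope itinerary `σ`. -/
def paramSet (p : ℕ) (σ : Fin p → Bool) : Set (UnitAddCircle × ℝ) :=
  {q | q.2 ∈ Set.Ico (0:ℝ) 1 ∧ ∃ x, IsAttractingPeriodicPt (plpdm q.1 q.2) p x ∧
       HasItinerary (plpdm q.1 q.2) p x σ}

/-- `S` is a tongue: its closure meets `ℝ/ℤ × {1}` in a nondegenerate interval. -/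
def IsTongue (S : Set (UnitAddCircle × ℝ)) : Prop :=
  ∃ u v : ℝ, u < v ∧ ∀ t ∈ Set.Icc u v, (((t : ℝ) : UnitAddCircle), (1:ℝ)) ∈ closure S

end


/-! ### Increasing maps of the real line -/

/-- A fixed point of an increasing map which attracts on its left has a one-sided basin `(l, x)`,
where `l` is the largest point on its left which does not move to the right. -/
theorem exists_left_basin {g : ℝ → ℝ} (hg : Continuous g) (hm : Monotone g) {x : ℝ}
    (hx : g x = x) (hne : ∃ y < x, g y ≤ y) (hε : ∃ ε > 0, ∀ y ∈ Ioo (x - ε) x, y < g y) :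
    ∃ l < x, g l ≤ l ∧ ∀ y ∈ Ioo l x, y < g y ∧ Tendsto (fun k => g^[k] y) atTop (𝓝 x) := by
  obtain ⟨y₀, hy₀, hgy₀⟩ := hne
  obtain ⟨ε, hε, hε'⟩ := hε
  set C : Set ℝ := {y | y ≤ x - ε ∧ g y ≤ y}
  have key : ∀ y < x, g y ≤ y → y ∈ C := fun y hy hgy =>
    ⟨by by_contra! h; exact (hε' y ⟨h, hy⟩).not_ge hgy, hgy⟩
  have hCne : C.Nonempty := ⟨y₀, key y₀ hy₀ hgy₀⟩
  have hCb : BddAbove C := ⟨x - ε, fun y hy => hy.1⟩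
  have hCc : IsClosed C := isClosed_Iic.inter (isClosed_le hg continuous_id)
  have hl : sSup C ∈ C := hCc.csSup_mem hCne hCb
  have hlt : ∀ y ∈ Ioo (sSup C) x, y < g y := by
    intro y hy
    by_contra! h
    exact (le_csSup hCb (key y hy.2 h)).not_gt hy.1
  refine ⟨sSup C, by linarith [hl.1], hl.2, fun y hy => ⟨hlt y hy, ?_⟩⟩
  have hmono : Monotone fun k => g^[k] y := hm.monotone_iterate_of_le_map (hlt y hy).le
  have hle : ∀ k, g^[k] y ≤ x := fun k => by
    have := hm.iterate k hy.2.le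
    rwa [Function.iterate_fixed hx] at this
  have hlim := tendsto_atTop_ciSup hmono ⟨x, by rintro _ ⟨k, rfl⟩; exact hle k⟩
  set z := ⨆ k, g^[k] y
  have hfix : g z = z := isFixedPt_of_tendsto_iterate hlim hg.continuousAt
  have hyz : y ≤ z := hmono.ge_of_tendsto hlim 0
  have hzx : z ≤ x := le_of_tendsto' hlim hle
  have : z = x := by
    refine hzx.eq_of_not_lt fun h => ?_
    exact (hlt z ⟨hy.1.trans_le hyz, h⟩).ne' hfix
  rwa [this] at hlim

/-- Iterates of an increasing continuous map are convex on an interval as long as the map is convex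
on each of the successive images of that interval. -/
theorem ConvexOn.iterate_of_strictMono {F : ℝ → ℝ} (hF : Continuous F) (hm : StrictMono F)
    {u v : ℝ} (huv : u ≤ v) {n : ℕ}
    (h : ∀ i < n, ConvexOn ℝ (Icc (F^[i] u) (F^[i] v)) F) : ConvexOn ℝ (Icc u v) F^[n] := by
  induction n with
  | zero => exact convexOn_id (convex_Icc u v)
  | succ n ih =>
    have himg : F^[n] '' Icc u v = Icc (F^[n] u) (F^[n] v) :=
      Subset.antisymm (hm.monotone.iterate n).image_Icc_subset
        (intermediate_value_Icc huv (hF.iterate n).continuousOn)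
    rw [Function.iterate_succ']
    refine ConvexOn.comp ?_ (ih fun i hi => h i (hi.trans n.lt_succ_self)) (hm.monotone.monotoneOn _)
    rw [himg]
    exact h n n.lt_succ_self

/-- A convex function with `g u ≤ u` and `g v = v` lies below the identity on `[u, v]`. -/
theorem ConvexOn.le_self_of_endpoints {g : ℝ → ℝ} {u v y : ℝ} (hg : ConvexOn ℝ (Icc u v) g)
    (hu : g u ≤ u) (hv : g v ≤ v) (hy : y ∈ Icc u v) : g y ≤ y := by
  have huv : u ≤ v := hy.1.trans hy.2
  rw [← segment_eq_Icc huv] at hy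
  obtain ⟨s, t, hs, ht, hst, rfl⟩ := hy
  refine (hg.2 (left_mem_Icc.2 huv) (right_mem_Icc.2 huv) hs ht hst).trans ?_
  simp only [smul_eq_mul]
  gcongr

/-! ### The lift of the perturbed doubling map -/

/-- A lift of `plpdm a b` to the real line. -/
noncomputable def plpdmLift (a : UnitAddCircle) (b t : ℝ) : ℝ :=
  2 * t + rep a + b / 2 * (4 * ‖(t : UnitAddCircle)‖ - 1)

theorem coe_rep (a : UnitAddCircle) : ((rep a : ℝ) : UnitAddCircle) = a :=
  AddCircle.coe_equivIco

theorem rep_coe (t : ℝ) : rep (t : UnitAddCircle) = Int.fract t := by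
  simp [rep]

theorem coe_add_intCast (t : ℝ) (m : ℤ) : ((t + m : ℝ) : UnitAddCircle) = t := by
  rw [AddCircle.coe_add, add_eq_left, AddCircle.coe_eq_zero_iff]
  exact ⟨m, by simp⟩

theorem eq_of_coe_eq_of_mem_Ioc {x t : ℝ} (ht : t ∈ Ioc (x - 1) x)
    (h : (t : UnitAddCircle) = x) : t = x :=
  (AddCircle.coe_eq_coe_iff_of_mem_Ioc (p := (1 : ℝ)) (a := x - 1) (by simpa using ht)
    (by simp)).1 h

theorem Sfun_fract (t : ℝ) : Sfun (Int.fract t) = 4 * ‖(t : UnitAddCircle)‖ - 1 := by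
  have h0 := Int.fract_nonneg t
  have h1 := Int.fract_lt_one t
  rw [UnitAddCircle.norm_eq, abs_sub_round_eq_min, Sfun]
  split_ifs with h
  · rw [min_eq_left (by linarith)]
  · rw [min_eq_right (by linarith)]
    ring

theorem coe_plpdmLift (a : UnitAddCircle) (b t : ℝ) :
    (plpdmLift a b t : UnitAddCircle) = plpdm a b t := by
  have h : plpdmLift a b t =
      2 * Int.fract t + b / 2 * Sfun (Int.fract t) + rep a + ((2 * ⌊t⌋ : ℤ) : ℝ) := by
    rw [plpdmLift, Sfun_fract, Int.fract]
    push_cast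
    ring
  rw [h, coe_add_intCast, plpdm, rep_coe, AddCircle.coe_add _ _ (rep a), coe_rep]

theorem coe_plpdmLift_iterate (a : UnitAddCircle) (b : ℝ) (n : ℕ) (t : ℝ) :
    ((plpdmLift a b)^[n] t : UnitAddCircle) = (plpdm a b)^[n] t :=
  (Function.Semiconj.iterate_right (f := fun t : ℝ => (t : UnitAddCircle))
    (coe_plpdmLift a b) n).eq t

theorem continuous_plpdmLift (a : UnitAddCircle) (b : ℝ) : Continuous (plpdmLift a b) := by
  have : Continuous fun t : ℝ => ‖(t : UnitAddCircle)‖ :=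
    continuous_norm.comp (AddCircle.continuous_mk' 1)
  unfold plpdmLift
  fun_prop

theorem strictMono_plpdmLift (a : UnitAddCircle) {b : ℝ} (hb : b ∈ Ico (0 : ℝ) 1) :
    StrictMono (plpdmLift a b) := by
  intro s t hst
  have h1 : ‖(s : UnitAddCircle)‖ - ‖(t : UnitAddCircle)‖ ≤ t - s := by
    refine (norm_sub_norm_le _ _).trans ?_
    rw [← AddCircle.coe_sub, UnitAddCircle.norm_eq]
    refine (round_le _ 0).trans_eq ?_
    rw [Int.cast_zero, sub_zero, abs_sub_comm, abs_of_pos (sub_pos.2 hst)]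
  simp only [plpdmLift]
  nlinarith [hb.1, hb.2]

theorem plpdmLift_iterate_add_intCast (a : UnitAddCircle) (b t : ℝ) (m : ℤ) (n : ℕ) :
    (plpdmLift a b)^[n] (t + m) = (plpdmLift a b)^[n] t + 2 ^ n * m := by
  induction n generalizing t m with
  | zero => simp
  | succ n ih =>
    have h : plpdmLift a b (t + m) = plpdmLift a b t + ((2 * m : ℤ) : ℝ) := by
      simp only [plpdmLift, coe_add_intCast]
      push_cast
      ring
    rw [Function.iterate_succ_apply, Function.iterate_succ_apply, h, ih]
    push_cast
    ring

/-- The lift is convex between consecutive half-integers. -/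
theorem convexOn_plpdmLift (a : UnitAddCircle) {b : ℝ} (hb : 0 ≤ b) {u v : ℝ} (huv : u < v)
    (h : ∀ m : ℤ, (m + 1 / 2 : ℝ) ∉ Ioo u v) : ConvexOn ℝ (Icc u v) (plpdmLift a b) := by
  obtain ⟨w, huw, hwv⟩ := exists_between huv
  set m := round w
  have hw := abs_le.1 (abs_sub_round w)
  have hv : v ≤ m + 1 / 2 := by
    by_contra! hv
    exact h m ⟨by linarith [hw.2], hv⟩
  have hu : m - 1 / 2 ≤ u := by
    by_contra! hu
    refine h (m - 1) ⟨?_, ?_⟩ <;> push_cast <;> linarith [hw.1]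
  have heq : ∀ t ∈ Icc u v, ‖(t : UnitAddCircle)‖ = |t - m| := by
    intro t ht
    have h1 : ‖((t - m : ℝ) : UnitAddCircle)‖ = |t - m| := by
      rw [AddCircle.norm_coe_eq_abs_iff _ one_ne_zero, abs_one, abs_le]
      constructor <;> linarith [ht.1, ht.2]
    rw [← h1, ← coe_add_intCast (t - m) m, sub_add_cancel]
  refine ConvexOn.congr (f := fun t : ℝ => 2 * t + rep a + b / 2 * (4 * |t - m| - 1)) ?_ ?_
  · refine ⟨convex_Icc u v, fun s _ t _ p q hp hq hpq => ?_⟩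
    have h1 : |p * s + q * t - m| ≤ p * |s - m| + q * |t - m| := by
      calc |p * s + q * t - m| = |p * (s - m) + q * (t - m)| := by
            congr 1
            linear_combination (m : ℝ) * hpq
        _ ≤ _ := (abs_add_le _ _).trans_eq (by
          rw [abs_mul, abs_mul, abs_of_nonneg hp, abs_of_nonneg hq])
    obtain rfl : q = 1 - p := by linarith
    simp only [smul_eq_mul]
    nlinarith [mul_le_mul_of_nonneg_left h1 hb]
  · intro t ht
    simp only [plpdmLift, heq t ht]

/-! ### Attracting periodic points -/

/-- The point `1/2` is attracted by every attracting periodic orbit. -/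
theorem IsAttractingPeriodicPt.exists_tendsto_half {a : UnitAddCircle} {b : ℝ}
    (hb : b ∈ Ico (0 : ℝ) 1) {n : ℕ} {x : UnitAddCircle}
    (h : IsAttractingPeriodicPt (plpdm a b) n x) :
    ∃ i, Tendsto (fun k => (plpdm a b)^[n * k] ((1 / 2 : ℝ) : UnitAddCircle)) atTop
      (𝓝 ((plpdm a b)^[i] x)) := by
  obtain ⟨hn, hper, -, U, hUo, -, hxU, hUU, hU⟩ := h
  obtain ⟨x, rfl⟩ := QuotientAddGroup.mk_surjective x
  change (plpdm a b)^[n] (x : UnitAddCircle) = x at hper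
  set F := plpdmLift a b with hF
  have hFc : Continuous F := continuous_plpdmLift a b
  have hFm : StrictMono F := strictMono_plpdmLift a hb
  obtain ⟨m, hm⟩ : ∃ m : ℤ, F^[n] x = x + m := by
    rw [← coe_plpdmLift_iterate, ← sub_eq_zero, ← AddCircle.coe_sub,
      AddCircle.coe_eq_zero_iff] at hper
    obtain ⟨m, hm⟩ := hper
    refine ⟨m, ?_⟩
    rw [zsmul_eq_mul, mul_one] at hm
    linarith
  set g : ℝ → ℝ := fun t => F^[n] t - m with hg
  have hgc : Continuous g := (hFc.iterate n).sub continuous_const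
  have hgm : StrictMono g := fun s t hst => sub_lt_sub_right (hFm.iterate n hst) _
  have hgx : g x = x := by simp [hg, hm]
  have hgadd : ∀ t (j : ℤ), g (t + j) = g t + 2 ^ n * j := fun t j => by
    simp only [hg, hF, plpdmLift_iterate_add_intCast]
    ring
  have hgcoe : ∀ k t, (g^[k] t : UnitAddCircle) = (plpdm a b)^[n * k] t := fun k t => by
    rw [Function.iterate_mul]
    refine (Function.Semiconj.iterate_right (f := fun t : ℝ => (t : UnitAddCircle))
      (fun t => ?_) k).eq t
    have := coe_add_intCast (F^[n] t) (-m)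
    push_cast at this
    rw [← coe_plpdmLift_iterate, ← hF, ← this, ← sub_eq_add_neg]
  have h2n : (2 : ℝ) ≤ 2 ^ n := by
    simpa using pow_le_pow_right₀ (one_le_two (α := ℝ)) hn
  -- a periodic point outside `U`
  obtain ⟨t, htx, htU⟩ : ∃ t ∈ Ioo (x - 1) x, (t : UnitAddCircle) ∉ U := by
    have hx1 : g (x - 1) = x - 2 ^ n := by
      have := hgadd x (-1)
      push_cast at this
      rw [sub_eq_add_neg, this, hgx]
      ring
    have hx2 : g (x - 2 ^ n) = x - 2 ^ n * 2 ^ n := by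
      have := hgadd x (-2 ^ n)
      push_cast at this
      rw [sub_eq_add_neg, this, hgx]
      ring
    obtain ⟨t, ht, hgt⟩ := intermediate_value_Ioo (f := fun t => g (g t) - t) (by linarith : x - 1 ≤ x)
      ((hgc.comp hgc).sub continuous_id).continuousOn
      (show (-1 : ℝ) ∈ Ioo _ _ by
        constructor
        · simp only [hx1, hx2]
          nlinarith
        · simp [hgx])
    refine ⟨t, ht, fun htU => ?_⟩
    have hfix : (plpdm a b)^[n * 2] (t : UnitAddCircle) = t := by
      rw [← hgcoe]
      have : g^[2] t = t + ((-1 : ℤ) : ℝ) := by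
        simp only [Function.iterate_succ_apply, Function.iterate_zero, id]
        push_cast
        linarith
      rw [this, coe_add_intCast]
    have hlim := (hU t htU).comp (tendsto_id.const_mul_atTop' (zero_lt_two (α := ℕ)))
    have hconst : ∀ k, (plpdm a b)^[n * (2 * k)] (t : UnitAddCircle) = t := fun k => by
      rw [← mul_assoc, Function.iterate_mul, Function.iterate_fixed hfix]
    simp only [Function.comp_def, id, hconst] at hlim
    have := tendsto_nhds_unique tendsto_const_nhds hlim
    exact ht.2.ne (eq_of_coe_eq_of_mem_Ioc ⟨ht.1, ht.2.le⟩ this)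
  -- points of `U` slightly on the left of `x` move to the right
  have hε : ∃ ε > 0, ∀ y ∈ Ioo (x - ε) x, y < g y := by
    have hnhds : {y : ℝ | (y : UnitAddCircle) ∈ U} ∈ 𝓝 x :=
      (hUo.preimage (AddCircle.continuous_mk' 1)).mem_nhds hxU
    obtain ⟨ε, hε, hball⟩ := Metric.mem_nhds_iff.1 hnhds
    refine ⟨ε, hε, fun y hy => ?_⟩
    by_contra! hgy
    have hsub : ∀ s ∈ Icc y x, (s : UnitAddCircle) ∈ U := fun s hs => by
      refine hball ?_
      rw [Metric.mem_ball, Real.dist_eq, abs_lt]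
      constructor <;> linarith [hs.1, hs.2, hy.1]
    have hstay : ∀ k, ∀ s ∈ Icc y x, (g^[k] s : UnitAddCircle) ∈ U := by
      intro k
      induction k with
      | zero => exact hsub
      | succ k ih =>
        intro s hs
        refine hUU ⟨_, ih s hs, ?_⟩
        rw [hgcoe, hgcoe, ← Function.iterate_add_apply, mul_add_one, add_comm]
    have hlow : ∀ k, t ≤ g^[k] y := by
      intro k
      by_contra! hk
      obtain ⟨s, hs, hst⟩ := intermediate_value_Icc hy.2.le (hgc.iterate k).continuousOn
        (show t ∈ Icc _ _ from ⟨hk.le, by rw [Function.iterate_fixed hgx]; exact htx.2.le⟩)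
      exact htU (hst ▸ hstay k s hs)
    have hanti : Antitone fun k => g^[k] y := hgm.monotone.antitone_iterate_of_map_le hgy
    have hlim := tendsto_atTop_ciInf hanti ⟨t, by rintro _ ⟨k, rfl⟩; exact hlow k⟩
    set z := ⨅ k, g^[k] y
    have hzy : z ≤ y := hanti.le_of_tendsto hlim 0
    have htz : t ≤ z := ge_of_tendsto' hlim hlow
    have h1 := ((AddCircle.continuous_mk' (1 : ℝ)).tendsto z).comp hlim
    have h2 := hU y (hsub y ⟨le_rfl, hy.2.le⟩)
    simp only [← hgcoe] at h2
    have hzx : z < x := hzy.trans_lt hy.2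
    exact hzx.ne (eq_of_coe_eq_of_mem_Ioc ⟨htx.1.trans_le htz, hzx.le⟩ (tendsto_nhds_unique h1 h2))
  obtain ⟨l, hlx, hgl, hbasin⟩ := exists_left_basin hgc hgm.monotone hgx
    ⟨x - 1, by linarith, by
      have := hgadd x (-1)
      push_cast at this
      rw [sub_eq_add_neg, this, hgx]
      linarith⟩ hε
  -- otherwise `g` would be convex on `[l, x]`
  obtain ⟨i, -, j, hj⟩ : ∃ i < n, ∃ j : ℤ, (j + 1 / 2 : ℝ) ∈ Ioo (F^[i] l) (F^[i] x) := by
    by_contra! hcon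
    have hconv : ConvexOn ℝ (Icc l x) F^[n] := ConvexOn.iterate_of_strictMono hFc hFm hlx.le
      fun i hi => convexOn_plpdmLift a hb.1 (hFm.iterate i hlx) (hcon i hi)
    have hconv' : ConvexOn ℝ (Icc l x) g := by
      simp only [hg, sub_eq_add_neg]
      exact hconv.add_const (-(m : ℝ))
    obtain ⟨y, hy⟩ := exists_between hlx
    exact (hconv'.le_self_of_endpoints hgl hgx.le ⟨hy.1.le, hy.2.le⟩).not_gt (hbasin y hy).1
  obtain ⟨y, hy, hyj⟩ := intermediate_value_Ioo hlx.le (hFc.iterate i).continuousOn hj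
  refine ⟨i, ?_⟩
  have hhalf : ((1 / 2 : ℝ) : UnitAddCircle) = (plpdm a b)^[i] (y : UnitAddCircle) := by
    rw [← coe_plpdmLift_iterate, ← hF, hyj, add_comm, coe_add_intCast]
  have hconj : ∀ k, (plpdm a b)^[n * k] ((1 / 2 : ℝ) : UnitAddCircle) =
      ((F^[i] (g^[k] y) : ℝ) : UnitAddCircle) := fun k => by
    rw [hhalf, coe_plpdmLift_iterate, hgcoe, ← Function.iterate_add_apply,
      ← Function.iterate_add_apply, add_comm]
  simp only [hconj]
  change Tendsto _ _ (𝓝 ((plpdm a b)^[i] (x : UnitAddCircle)))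
  rw [← coe_plpdmLift_iterate]
  exact (((AddCircle.continuous_mk' (1 : ℝ)).comp (hFc.iterate i)).tendsto x).comp (hbasin y hy).2

/-- Points on the same periodic orbit have the same forward orbit. -/
theorem orbitSet_iterate {f : UnitAddCircle → UnitAddCircle} {n : ℕ} {x : UnitAddCircle}
    (hn : 0 < n) (hx : f^[n] x = x) (i : ℕ) : orbitSet f (f^[i] x) = orbitSet f x := by
  ext y
  constructor
  · rintro ⟨j, rfl⟩
    exact ⟨j + i, Function.iterate_add_apply f j i x⟩
  · rintro ⟨j, rfl⟩
    have hle : i ≤ j + n * i := by nlinarith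
    refine ⟨j + n * i - i, ?_⟩
    rw [← Function.iterate_add_apply, Nat.sub_add_cancel hle, Function.iterate_add_apply,
      Function.iterate_mul, Function.iterate_fixed hx]

theorem stmt2 (a : UnitAddCircle) (b : ℝ) (h : (a, b) ∈ hypSet) :
    ∃! O : Set UnitAddCircle, ∃ n x, IsAttractingPeriodicPt (plpdm a b) n x ∧
      O = orbitSet (plpdm a b) x := by
  obtain ⟨hb, n, x, hx⟩ := h
  refine ⟨orbitSet (plpdm a b) x, ⟨n, x, hx, rfl⟩, ?_⟩
  rintro _ ⟨n', x', hx', rfl⟩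
  obtain ⟨i, hi⟩ := IsAttractingPeriodicPt.exists_tendsto_half hb hx
  obtain ⟨i', hi'⟩ := IsAttractingPeriodicPt.exists_tendsto_half hb hx'
  have h1 := hi.comp (tendsto_id.const_mul_atTop' hx'.1)
  have h2 := hi'.comp (tendsto_id.const_mul_atTop' hx.1)
  simp only [Function.comp_def, id] at h1 h2
  have heq : (plpdm a b)^[i'] x' = (plpdm a b)^[i] x :=
    tendsto_nhds_unique (h2.congr fun k => by rw [mul_left_comm]) h1
  rw [← orbitSet_iterate hx.1 hx.2.1 i, ← orbitSet_iterate hx'.1 hx'.2.1 i', heq]
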